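/- Decomposition Theorem: Let (Σ, L, κ) be a state property system satisfying the axiom OrthoCom. Then the map n from the product ∏_{ω ∈ Ω} {a ∈ L | a ≤ ω} to L defined by n((a_ω)_ω) = ⨆_{ω ∈ Ω} a_ω is a bijection with inverse a ↦ (a ⊓ ω)_ω, it satisfies κ(n((a_ω)_ω)) = ⋃_{ω ∈ Ω} κ(a_ω), and it intertwines orthocomplementations: (⨆_{ω ∈ Ω} a_ω)ᗮ = ⨆_{ω ∈ Ω} (a_ωᗮ ⊓ ω) whenever a_ω ≤ ω for all ω ∈ Ω. -/

import Mathlib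

/-- A state property system `(σ, L, κ)` equipped with an orthocomplementation
satisfying the axiom **OrthoCom**. -/
structure OrthoSPS (σ : Type*) (L : Type*) [CompleteLattice L] where
  /-- the Cartan map -/
  κ : L → Set σ
  κ_bot : κ ⊥ = ∅
  κ_top : κ ⊤ = Set.univ
  κ_sInf : ∀ s : Set L, κ (sInf s) = ⋂ a ∈ s, κ a
  le_iff : ∀ a b : L, a ≤ b ↔ κ a ⊆ κ b
  /-- the orthocomplementation -/
  perp : L → L
  perp_perp : ∀ a : L, perp (perp a) = a
  perp_anti : ∀ a b : L, a ≤ b → perp b ≤ perp a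
  inf_perp : ∀ a : L, a ⊓ perp a = ⊥
  sup_perp : ∀ a : L, a ⊔ perp a = ⊤
  /-- axiom OrthoCom: any state orthogonal to every state in `κ a` lies in `κ (perp a)` -/
  orthoCom : ∀ (a : L) (q : σ),
    (∀ p ∈ κ a, ∃ b : L, q ∈ κ b ∧ p ∈ κ (perp b)) → q ∈ κ (perp a)

namespace OrthoSPS

variable {σ : Type*} {L : Type*} [CompleteLattice L]

/-- orthogonality of two states: `p ⊥ q` -/
def PerpState (S : OrthoSPS σ L) (p q : σ) : Prop :=
  ∃ a : L, p ∈ S.κ a ∧ q ∈ S.κ (S.perp a)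

/-- a property `a` is classical if every state is in `κ a` or in `κ (perp a)` -/
def IsClassical (S : OrthoSPS σ L) (a : L) : Prop :=
  ∀ p : σ, p ∈ S.κ a ∨ p ∈ S.κ (S.perp a)

/-- the classical state `ω p` of a state `p`: the infimum of all classical properties
actual in `p` -/
def classicalState (S : OrthoSPS σ L) (p : σ) : L :=
  sInf {a : L | S.IsClassical a ∧ p ∈ S.κ a}

/-- `Ω`, the set of all classical states -/
def Omega (S : OrthoSPS σ L) : Set L :=
  Set.range S.classicalState

/-- the classical Cartan map `κ_c` -/
def κc (S : OrthoSPS σ L) (a : L) : Set L :=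
  S.classicalState '' S.κ a

end OrthoSPS

namespace OrthoSPS

variable {σ : Type*} {L : Type*} [CompleteLattice L] (S : OrthoSPS σ L)

theorem κ_inf (a b : L) : S.κ (a ⊓ b) = S.κ a ∩ S.κ b := by
  rw [← sInf_pair, S.κ_sInf, Set.biInter_pair]

theorem mem_κ_of_le {a b : L} (h : a ≤ b) {p : σ} (hp : p ∈ S.κ a) : p ∈ S.κ b :=
  (S.le_iff a b).1 h hp

theorem notMem_κ_perp {a : L} {p : σ} (h : p ∈ S.κ a) : p ∉ S.κ (S.perp a) := fun h' => by
  have : p ∈ S.κ (a ⊓ S.perp a) := by rw [κ_inf]; exact ⟨h, h'⟩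
  rw [S.inf_perp, S.κ_bot] at this
  exact this

theorem mem_κ_iInf {ι : Sort*} (f : ι → L) (p : σ) :
    p ∈ S.κ (⨅ i, f i) ↔ ∀ i, p ∈ S.κ (f i) := by
  rw [iInf, S.κ_sInf]
  simp

theorem le_perp_symm {a b : L} (h : a ≤ S.perp b) : b ≤ S.perp a := by
  simpa only [S.perp_perp] using S.perp_anti _ _ h

theorem perp_iSup {ι : Sort*} (f : ι → L) : S.perp (⨆ i, f i) = ⨅ i, S.perp (f i) :=
  le_antisymm (le_iInf fun i => S.perp_anti _ _ (le_iSup f i))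
    (S.le_perp_symm (iSup_le fun i => S.le_perp_symm (iInf_le _ i)))

theorem IsClassical.perp {S : OrthoSPS σ L} {a : L} (h : S.IsClassical a) :
    S.IsClassical (S.perp a) := fun p => by
  rw [S.perp_perp]
  exact (h p).symm

theorem isClassical_sInf {s : Set L} (h : ∀ a ∈ s, S.IsClassical a) :
    S.IsClassical (sInf s) := fun p => by
  by_cases hp : ∀ a ∈ s, p ∈ S.κ a
  · left
    rw [S.κ_sInf]
    exact Set.mem_iInter₂.2 hp
  · push Not at hp
    obtain ⟨a, ha, hpa⟩ := hp
    exact Or.inr (S.mem_κ_of_le (S.perp_anti _ _ (sInf_le ha)) ((h a ha p).resolve_left hpa))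

theorem isClassical_classicalState (p : σ) : S.IsClassical (S.classicalState p) :=
  S.isClassical_sInf fun _ ha => ha.1

theorem mem_κ_classicalState (p : σ) : p ∈ S.κ (S.classicalState p) := by
  rw [classicalState, S.κ_sInf]
  exact Set.mem_iInter₂.2 fun _ ha => ha.2

theorem classicalState_le {a : L} (ha : S.IsClassical a) {p : σ} (hp : p ∈ S.κ a) :
    S.classicalState p ≤ a :=
  sInf_le ⟨ha, hp⟩

theorem isClassical_of_mem_Omega {w : L} (hw : w ∈ S.Omega) : S.IsClassical w := by
  obtain ⟨p, rfl⟩ := hw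
  exact S.isClassical_classicalState p

theorem classicalState_eq_of_mem_κ {w : L} (hw : w ∈ S.Omega) {q : σ} (hq : q ∈ S.κ w) :
    S.classicalState q = w := by
  obtain ⟨p, rfl⟩ := hw
  refine le_antisymm (S.classicalState_le (S.isClassical_classicalState p) hq)
    (S.classicalState_le (S.isClassical_classicalState q) ?_)
  by_contra hp
  have hp' := (S.isClassical_classicalState q p).resolve_left hp
  exact S.notMem_κ_perp (S.mem_κ_classicalState q)
    (S.mem_κ_of_le (S.classicalState_le (S.isClassical_classicalState q).perp hp') hq)

theorem eq_of_mem_κ {v w : S.Omega} {q : σ} (hv : q ∈ S.κ v) (hw : q ∈ S.κ w) : v = w :=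
  Subtype.ext ((S.classicalState_eq_of_mem_κ v.2 hv).symm.trans
    (S.classicalState_eq_of_mem_κ w.2 hw))

theorem exists_mem_κ_Omega (p : σ) : ∃ w : S.Omega, p ∈ S.κ w :=
  ⟨⟨S.classicalState p, p, rfl⟩, S.mem_κ_classicalState p⟩

/-- A state below `w` satisfies the orthocomplement of a join of components as soon as it
satisfies the orthocomplement of the component at `w`. -/
theorem mem_κ_perp_iSup {f : S.Omega → L} (hf : ∀ w, f w ≤ w) {w : S.Omega} {q : σ}
    (hqw : q ∈ S.κ w) (hq : q ∈ S.κ (S.perp (f w))) : q ∈ S.κ (S.perp (⨆ w, f w)) := by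
  rw [perp_iSup, mem_κ_iInf]
  intro v
  by_cases hqv : q ∈ S.κ v
  · rwa [S.eq_of_mem_κ hqv hqw]
  · exact S.mem_κ_of_le (S.perp_anti _ _ (hf v))
      ((S.isClassical_of_mem_Omega v.2 q).resolve_left hqv)

theorem κ_iSup_of_le {f : S.Omega → L} (hf : ∀ w, f w ≤ w) :
    S.κ (⨆ w, f w) = ⋃ w, S.κ (f w) := by
  ext p
  rw [Set.mem_iUnion]
  refine ⟨fun hp => ?_, fun ⟨w, hw⟩ => S.mem_κ_of_le (le_iSup f w) hw⟩
  obtain ⟨w, hpw⟩ := S.exists_mem_κ_Omega p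
  refine ⟨w, ?_⟩
  rw [← S.perp_perp (f w)]
  refine S.orthoCom _ _ fun q hq => ?_
  by_cases hqw : q ∈ S.κ w
  · exact ⟨_, hp, S.mem_κ_perp_iSup hf hqw hq⟩
  · exact ⟨w, hpw, (S.isClassical_of_mem_Omega w.2 q).resolve_left hqw⟩

theorem iSup_inf_eq_of_le {f : S.Omega → L} (hf : ∀ w, f w ≤ w) (w : S.Omega) :
    (⨆ v, f v) ⊓ w = f w := by
  refine le_antisymm ((S.le_iff _ _).2 fun p hp => ?_) (le_inf (le_iSup f w) (hf w))
  rw [κ_inf, S.κ_iSup_of_le hf] at hp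
  obtain ⟨hp, hpw⟩ := hp
  obtain ⟨v, hpv⟩ := Set.mem_iUnion.1 hp
  rwa [S.eq_of_mem_κ hpw (S.mem_κ_of_le (hf v) hpv)]

theorem iSup_inf_Omega (a : L) : ⨆ w : S.Omega, a ⊓ w = a := by
  refine le_antisymm (iSup_le fun w => inf_le_left) ((S.le_iff _ _).2 fun p hp => ?_)
  obtain ⟨w, hpw⟩ := S.exists_mem_κ_Omega p
  refine S.mem_κ_of_le (le_iSup (fun w : S.Omega => a ⊓ (w : L)) w) ?_
  rw [κ_inf]
  exact ⟨hp, hpw⟩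

theorem perp_iSup_of_le {f : S.Omega → L} (hf : ∀ w, f w ≤ w) :
    S.perp (⨆ w, f w) = ⨆ w : S.Omega, S.perp (f w) ⊓ w := by
  apply le_antisymm
  · rw [← S.iSup_inf_Omega (S.perp _)]
    exact iSup_mono fun w => inf_le_inf_right _ (S.perp_anti _ _ (le_iSup f w))
  · refine iSup_le fun w => (S.le_iff _ _).2 fun p hp => ?_
    rw [κ_inf] at hp
    exact S.mem_κ_perp_iSup hf hp.2 hp.1

end OrthoSPS

/-- Decomposition Theorem: the map
`n : (a_ω)_ω ↦ ⨆_{ω ∈ Ω} a_ω` from the product of the nonclassical components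
`{a | a ≤ ω}` to `L` is a bijection with inverse `a ↦ (a ⊓ ω)_ω`, satisfies
`κ (n (a_ω)_ω) = ⋃_ω κ (a_ω)`, and intertwines the orthocomplementations. -/
theorem decomposition_theorem {σ L : Type*} [CompleteLattice L] (S : OrthoSPS σ L) :
    Function.Bijective
      (fun f : (∀ w : S.Omega, {a : L // a ≤ (w : L)}) => ⨆ w : S.Omega, (f w : L)) ∧
    (∀ f : (∀ w : S.Omega, {a : L // a ≤ (w : L)}), ∀ w : S.Omega,
      (⨆ w' : S.Omega, (f w' : L)) ⊓ (w : L) = (f w : L)) ∧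
    (∀ a : L, ⨆ w : S.Omega, (a ⊓ (w : L)) = a) ∧
    (∀ f : (∀ w : S.Omega, {a : L // a ≤ (w : L)}),
      S.κ (⨆ w : S.Omega, (f w : L)) = ⋃ w : S.Omega, S.κ (f w : L)) ∧
    (∀ f : (∀ w : S.Omega, {a : L // a ≤ (w : L)}),
      S.perp (⨆ w : S.Omega, (f w : L)) = ⨆ w : S.Omega, (S.perp (f w : L) ⊓ (w : L))) := by
  have inv (f : ∀ w : S.Omega, {a : L // a ≤ (w : L)}) (w : S.Omega) :
      (⨆ v : S.Omega, (f v : L)) ⊓ (w : L) = (f w : L) :=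
    S.iSup_inf_eq_of_le (fun v => (f v).2) w
  refine ⟨⟨fun f g h => ?_, fun a => ⟨fun w => ⟨a ⊓ w, inf_le_right⟩, S.iSup_inf_Omega a⟩⟩,
    inv, S.iSup_inf_Omega, fun f => S.κ_iSup_of_le fun w => (f w).2,
    fun f => S.perp_iSup_of_le fun w => (f w).2⟩
  funext w
  apply Subtype.ext
  rw [← inv f, ← inv g]
  exact congrArg (· ⊓ (w : L)) h
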